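/- If w is a generalized trapezoidal word and u is a nonempty factor of w, then u is a generalized trapezoidal word. -/

import Mathlib

open List

variable {A : Type*} [DecidableEq A]

/-- The alphabet of a word: the finite set of distinct letters occurring in it. -/
def Alph (w : List A) : Finset A := w.toFinset

/-- The finset of all factors (contiguous subwords) of `w`. -/
def factors (w : List A) : Finset (List A) :=
  ((Finset.range (w.length + 1)) ×ˢ (Finset.range (w.length + 1))).image
    (fun p => (w.drop p.1).take p.2)

/-- Factor complexity: the number of distinct factors of `w` of length `n`. -/
def C (w : List A) (n : ℕ) : ℕ := ((factors w).filter (fun u => u.length = n)).card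

/-- Right-valence of `u` in `w`: the number of distinct letters `x` such that `u ++ [x]`
is a factor of `w`. -/
def rightValence (w u : List A) : ℕ := ((Alph w).filter (fun x => u ++ [x] <:+: w)).card

/-- `u` is a right special factor of `w`. -/
def RightSpecial (w u : List A) : Prop := u <:+: w ∧ 2 ≤ rightValence w u

/-- `R w`: the smallest positive integer `r` such that `w` has no right special factor
of length `r`. -/
noncomputable def R (w : List A) : ℕ :=
  sInf {r : ℕ | 0 < r ∧ ∀ u : List A, u.length = r → ¬ RightSpecial w u}

/-- The number of occurrences of `u` as a factor of `w`. -/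
def occCount (w u : List A) : ℕ :=
  ((Finset.range (w.length + 1)).filter
    (fun i => i + u.length ≤ w.length ∧ (w.drop i).take u.length = u)).card

/-- `K w`: the length of the shortest suffix of `w` occurring exactly once in `w`. -/
noncomputable def K (w : List A) : ℕ :=
  sInf {k : ℕ | ∃ u : List A, u <:+ w ∧ u.length = k ∧ occCount w u = 1}

/-- Left-valence of `u` in `w`. -/
def leftValence (w u : List A) : ℕ := ((Alph w).filter (fun x => x :: u <:+: w)).card

/-- `u` is a left special factor of `w`. -/
def LeftSpecial (w u : List A) : Prop := u <:+: w ∧ 2 ≤ leftValence w u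

/-- `L w`: the smallest positive integer `ℓ` such that `w` has no left special factor
of length `ℓ`. -/
noncomputable def L (w : List A) : ℕ :=
  sInf {r : ℕ | 0 < r ∧ ∀ u : List A, u.length = r → ¬ LeftSpecial w u}

/-- `H w`: the length of the shortest prefix of `w` occurring exactly once in `w`. -/
noncomputable def H (w : List A) : ℕ :=
  sInf {k : ℕ | ∃ u : List A, u <+: w ∧ u.length = k ∧ occCount w u = 1}

/-- A generalized trapezoidal word. -/
def IsGT (w : List A) : Prop :=
  w ≠ [] ∧ ((Alph w).card = 1 ∨
    ∃ m M : ℕ, 0 < m ∧ m ≤ M ∧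
      (∀ i, 1 ≤ i → i ≤ m → C w i = (Alph w).card + i - 1) ∧
      (∀ i, m ≤ i → i ≤ M - 1 → C w (i + 1) = C w i) ∧
      (∀ i, M ≤ i → i ≤ w.length → C w (i + 1) = C w i - 1))

/-- The heart of a word: remove the longest prefix and longest suffix consisting of
letters that occur exactly once in the word (if some letter repeats); otherwise the
word itself. -/
def heart (w : List A) : List A :=
  if ∀ x ∈ w, w.count x = 1 then w
  else
    ((w.dropWhile (fun x => w.count x == 1)).reverse.dropWhile
      (fun x => w.count x == 1)).reverse

/-- A word is rich if it has exactly `|w| + 1` distinct palindromic factors. -/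
def Rich (w : List A) : Prop :=
  ((factors w).filter (fun u => u.reverse = u)).card = w.length + 1

/-- `p` is a period of `w`. -/
def IsPeriod (w : List A) (p : ℕ) : Prop :=
  0 < p ∧ ∀ i : ℕ, i + p < w.length → w[i]? = w[i + p]?

/-- The minimal period of `w`. -/
noncomputable def minPeriod (w : List A) : ℕ := sInf {p : ℕ | IsPeriod w p}


/-- Factors of length `i`. -/
def FF (w : List A) (i : ℕ) : Finset (List A) := (factors w).filter (fun u => u.length = i)

theorem mem_FF (w f : List A) (i : ℕ) : f ∈ FF w i ↔ f <:+: w ∧ f.length = i := by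
  unfold FF factors
  simp only [Finset.mem_filter, Finset.mem_image, Finset.mem_product, Finset.mem_range]
  constructor
  · rintro ⟨⟨p, _, rfl⟩, h⟩
    exact ⟨(List.take_prefix _ _).isInfix.trans (List.drop_suffix _ _).isInfix, h⟩
  · rintro ⟨⟨s, t, rfl⟩, h⟩
    refine ⟨⟨(s.length, f.length), ⟨?_, ?_⟩, ?_⟩, h⟩
    · simp only [List.length_append]; omega
    · simp only [List.length_append]; omega
    · simp

theorem C_eq (w : List A) (i : ℕ) : C w i = (FF w i).card := rfl

theorem C_big (w : List A) (i : ℕ) (h : w.length < i) : C w i = 0 := by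
  rw [C_eq, Finset.card_eq_zero, Finset.eq_empty_iff_forall_notMem]
  intro f hf
  rw [mem_FF] at hf
  have := hf.1.length_le
  omega

theorem C_len (w : List A) : C w w.length = 1 := by
  rw [C_eq, Finset.card_eq_one]
  refine ⟨w, ?_⟩
  ext f
  rw [mem_FF, Finset.mem_singleton]
  constructor
  · rintro ⟨h1, h2⟩
    exact h1.eq_of_length h2
  · rintro rfl
    exact ⟨List.infix_rfl, rfl⟩

theorem C_pos (w : List A) (i : ℕ) (h : i ≤ w.length) : 0 < C w i := by
  rw [C_eq, Finset.card_pos]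
  refine ⟨w.take i, ?_⟩
  rw [mem_FF]
  exact ⟨(List.take_prefix _ _).isInfix, by simp [h]⟩

theorem C_one (w : List A) : C w 1 = (Alph w).card := by
  rw [C_eq]
  have : FF w 1 = (Alph w).image (fun x => [x]) := by
    ext f
    rw [mem_FF, Finset.mem_image]
    constructor
    · rintro ⟨h1, h2⟩
      obtain ⟨x, rfl⟩ := List.length_eq_one_iff.1 h2
      exact ⟨x, by simpa [Alph] using h1.subset (List.mem_singleton_self x), rfl⟩
    · rintro ⟨x, hx, rfl⟩
      have hx' : x ∈ w := by simpa [Alph] using hx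
      obtain ⟨s, t, rfl⟩ := List.append_of_mem hx'
      exact ⟨⟨s, t, by simp⟩, rfl⟩
  rw [this, Finset.card_image_of_injective]
  intro a b h
  simpa using h

theorem C_rev (w : List A) (i : ℕ) : C w.reverse i = C w i := by
  rw [C_eq, C_eq]
  have : FF w.reverse i = (FF w i).image List.reverse := by
    ext f
    rw [mem_FF, Finset.mem_image]
    constructor
    · rintro ⟨h1, h2⟩
      refine ⟨f.reverse, ?_, by simp⟩
      rw [mem_FF]
      refine ⟨?_, by simpa using h2⟩
      rw [← List.reverse_infix]; simpa using h1
    · rintro ⟨g, hg, rfl⟩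
      rw [mem_FF] at hg
      exact ⟨List.reverse_infix.2 hg.1, by simpa using hg.2⟩
  rw [this, Finset.card_image_of_injective _ List.reverse_injective]

theorem GT_rev (w : List A) (h : IsGT w) : IsGT w.reverse := by
  have e : Alph w.reverse = Alph w := by simp [Alph]
  unfold IsGT at *
  rw [e]
  simp only [C_rev, List.length_reverse]
  simpa using h

theorem mem_rext (w f : List A) (x : A) :
    x ∈ (Alph w).filter (fun x => f ++ [x] <:+: w) ↔ f ++ [x] <:+: w := by
  rw [Finset.mem_filter]
  constructor
  · exact fun h => h.2
  · intro h
    refine ⟨?_, h⟩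
    have : x ∈ w := h.subset (by simp)
    simpa [Alph] using this

theorem C_succ (w : List A) (i : ℕ) : C w (i + 1) = ∑ f ∈ FF w i, rightValence w f := by
  rw [C_eq, Finset.card_eq_sum_card_fiberwise (f := List.dropLast) (t := FF w i)]
  · apply Finset.sum_congr rfl
    intro f hf
    rw [mem_FF] at hf
    unfold rightValence
    symm
    apply Finset.card_bij (fun x _ => f ++ [x])
    · intro x hx
      rw [mem_rext] at hx
      rw [Finset.mem_filter, mem_FF]
      exact ⟨⟨hx, by simp [hf.2]⟩, by simp⟩
    · intro a _ b _ h
      simpa using h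
    · intro g hg
      rw [Finset.mem_filter, mem_FF] at hg
      have hne : g ≠ [] := by
        rintro rfl
        simp at hg
      refine ⟨g.getLast hne, ?_, ?_⟩
      · rw [mem_rext, ← hg.2, List.dropLast_append_getLast]
        exact hg.1.1
      · rw [← hg.2, List.dropLast_append_getLast]
  · intro g hg
    have hg := (mem_FF _ _ _).1 (Finset.mem_coe.1 hg)
    apply Finset.mem_coe.2
    rw [mem_FF]
    refine ⟨(List.dropLast_prefix g).isInfix.trans hg.1, ?_⟩
    simp [hg.2]

/-- The suffix of length `i` of `v ++ [a]` occurs in `v`. -/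
def PP (v : List A) (a : A) (i : ℕ) : Prop := (v ++ [a]).drop ((v ++ [a]).length - i) <:+: v

theorem infix_snoc (v f : List A) (a : A) : f <:+: v ++ [a] ↔ f <:+: v ∨ f <:+ v ++ [a] := by
  constructor
  · rintro ⟨s, t, h⟩
    rcases List.eq_nil_or_concat t with rfl | ⟨t', b, rfl⟩
    · right; exact ⟨s, by simpa using h⟩
    · left
      refine ⟨s, t', ?_⟩
      have : (s ++ f ++ t') ++ [b] = v ++ [a] := by simpa using h
      exact (List.append_inj' this rfl).1
  · rintro (h | h)
    · exact h.trans (List.prefix_append _ _).isInfix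
    · exact h.isInfix

theorem ext_infix (v f : List A) (a x : A) (h : f ++ [x] <:+: v ++ [a]) : f <:+: v := by
  rw [infix_snoc] at h
  rcases h with h | ⟨s, h⟩
  · exact (List.prefix_append _ _).isInfix.trans h
  · have : (s ++ f) ++ [x] = v ++ [a] := by simpa using h
    exact ⟨s, [], by simpa using (List.append_inj' this rfl).1⟩

theorem infix_ext (v f : List A) (a : A) (h : f <:+: v) : ∃ x, f ++ [x] <:+: v ++ [a] := by
  obtain ⟨s, t, rfl⟩ := h
  cases t with
  | nil => exact ⟨a, s, [], by simp⟩
  | cons b t => exact ⟨b, s, t ++ [a], by simp⟩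

theorem FF_snoc (v : List A) (a : A) (i : ℕ) (hi : i ≤ v.length + 1) :
    FF (v ++ [a]) i = insert ((v ++ [a]).drop ((v ++ [a]).length - i)) (FF v i) := by
  ext f
  rw [Finset.mem_insert, mem_FF, mem_FF, infix_snoc]
  constructor
  · rintro ⟨h | h, h2⟩
    · exact Or.inr ⟨h, h2⟩
    · left
      rw [← h2]; exact List.suffix_iff_eq_drop.1 h
  · rintro (rfl | h)
    · exact ⟨Or.inr (List.drop_suffix _ _), by simp; omega⟩
    · exact ⟨Or.inl h.1, h.2⟩

theorem C_snoc_pos (v : List A) (a : A) (i : ℕ) (hi : i ≤ v.length + 1) (h : PP v a i) :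
    C (v ++ [a]) i = C v i := by
  rw [C_eq, C_eq, FF_snoc v a i hi, Finset.insert_eq_of_mem]
  rw [mem_FF]
  exact ⟨h, by simp; omega⟩

theorem C_snoc_neg (v : List A) (a : A) (i : ℕ) (hi : i ≤ v.length + 1) (h : ¬ PP v a i) :
    C (v ++ [a]) i = C v i + 1 := by
  rw [C_eq, C_eq, FF_snoc v a i hi, Finset.card_insert_of_notMem]
  rw [mem_FF]
  exact fun h' => h h'.1

theorem PP_mono (v : List A) (a : A) (i j : ℕ) (hij : i ≤ j) (h : PP v a j) : PP v a i := by
  unfold PP at *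
  refine List.IsInfix.trans (List.IsSuffix.isInfix ?_) h
  exact List.drop_suffix_drop_left _ (by omega)

theorem PP_FF (v f : List A) (a : A) (i : ℕ) (hi : i ≤ v.length + 1) (h : PP v a i)
    (hf : f ∈ FF (v ++ [a]) i) : f <:+: v := by
  rw [FF_snoc v a i hi, Finset.mem_insert, mem_FF] at hf
  rcases hf with rfl | hf
  · exact h
  · exact hf.1

theorem rv_pos (v f : List A) (a : A) (i : ℕ) (hi : i ≤ v.length + 1) (h : PP v a i)
    (hf : f ∈ FF (v ++ [a]) i) : 1 ≤ rightValence (v ++ [a]) f := by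
  obtain ⟨x, hx⟩ := infix_ext v f a (PP_FF v f a i hi h hf)
  unfold rightValence
  exact Finset.card_pos.2 ⟨x, (mem_rext _ _ _).2 hx⟩

theorem rv_zero (v f : List A) (a : A) (h : ¬ f <:+: v) : rightValence (v ++ [a]) f = 0 := by
  unfold rightValence
  rw [Finset.card_eq_zero, Finset.eq_empty_iff_forall_notMem]
  intro x hx
  rw [mem_rext] at hx
  exact h (ext_infix v f a x hx)

theorem ext_suffix (w f g : List A) (h : g <:+ f) :
    (Alph w).filter (fun x => f ++ [x] <:+: w) ⊆ (Alph w).filter (fun x => g ++ [x] <:+: w) := by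
  intro x hx
  rw [mem_rext] at *
  obtain ⟨s, rfl⟩ := h
  exact List.IsInfix.trans ⟨s, [], by simp⟩ hx

theorem rv_suffix (w f g : List A) (h : g <:+ f) : rightValence w f ≤ rightValence w g :=
  Finset.card_le_card (ext_suffix w f g h)

theorem C_mono_PP (v : List A) (a : A) (i : ℕ) (hi : i ≤ v.length + 1) (h : PP v a i) :
    C (v ++ [a]) i ≤ C (v ++ [a]) (i + 1) := by
  rw [C_succ, C_eq, Finset.card_eq_sum_ones]
  exact Finset.sum_le_sum fun f hf => rv_pos v f a i hi h hf

/-- Case `m < K < M` is impossible. -/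
theorem case_mid (v : List A) (a : A) (m k : ℕ) (hk : k ≤ v.length + 1) (hmk : m ≤ k)
    (hm : PP v a m) (hK : ¬ PP v a k) (h1 : C (v ++ [a]) (m + 1) = C (v ++ [a]) m) :
    C (v ++ [a]) (k + 1) ≠ C (v ++ [a]) k := by
  have hr : ∀ f ∈ FF (v ++ [a]) m, rightValence (v ++ [a]) f = 1 := by
    rw [C_succ, C_eq, Finset.card_eq_sum_ones] at h1
    have := (Finset.sum_eq_sum_iff_of_le
      (fun f hf => rv_pos v f a m (by omega) hm hf)).1 h1.symm
    exact fun f hf => (this f hf).symm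
  have hlt : C (v ++ [a]) (k + 1) < C (v ++ [a]) k := by
    rw [C_succ, C_eq, Finset.card_eq_sum_ones]
    apply Finset.sum_lt_sum
    · intro f hf
      rw [mem_FF] at hf
      have hs : f.drop (f.length - m) <:+ f := List.drop_suffix _ _
      calc _ ≤ _ := rv_suffix _ _ _ hs
        _ = 1 := hr _ (by
          rw [mem_FF]
          exact ⟨hs.isInfix.trans hf.1, by simp; omega⟩)
        _ ≤ 1 := le_rfl
    · refine ⟨(v ++ [a]).drop ((v ++ [a]).length - k), ?_, ?_⟩
      · rw [mem_FF]
        exact ⟨(List.drop_suffix _ _).isInfix, by simp; omega⟩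
      · rw [rv_zero _ _ _ hK]; exact Nat.one_pos
  omega

/-- Two letters extending the same non right-special factor agree. -/
theorem rv_unique (w f : List A) (x y : A) (h : rightValence w f ≤ 1)
    (hx : f ++ [x] <:+: w) (hy : f ++ [y] <:+: w) : x = y := by
  unfold rightValence at h
  exact Finset.card_le_one.1 h x ((mem_rext _ _ _).2 hx) y ((mem_rext _ _ _).2 hy)

theorem win_infix (w : List A) (i n : ℕ) : (w.drop i).take n <:+: w :=
  (List.take_prefix _ _).isInfix.trans (List.drop_suffix _ _).isInfix

theorem win_succ (w : List A) (i n : ℕ) (h : i + n < w.length) :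
    (w.drop i).take n ++ [w[i + n]] = (w.drop i).take (n + 1) := by
  rw [List.take_add_one]
  simp [h]

theorem infix_win (w f : List A) (h : f <:+: w) :
    ∃ i, i + f.length ≤ w.length ∧ (w.drop i).take f.length = f := by
  obtain ⟨s, t, rfl⟩ := h
  exact ⟨s.length, by simp, by simp⟩

theorem win_get (w : List A) (i j n r : ℕ) (h : (w.drop i).take n = (w.drop j).take n)
    (hr : r < n) : w[i + r]? = w[j + r]? := by
  have := congrArg (fun l => l[r]?) h
  simpa [List.getElem?_take, hr] using this

theorem win_ext (w : List A) (i j n : ℕ) (h : ∀ r < n, w[i + r]? = w[j + r]?) :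
    (w.drop i).take n = (w.drop j).take n := by
  apply List.ext_getElem?
  intro r
  by_cases hr : r < n
  · simpa [List.getElem?_take, hr] using h r hr
  · simp [List.getElem?_take, hr]

/-- Structural consequence of the counting: existence of `z`. -/
theorem exists_z (v : List A) (a : A) (N : ℕ) (hN : N + 1 ≤ v.length + 1)
    (hP : PP v a N) (hK : ¬ PP v a (N + 1))
    (h1 : C (v ++ [a]) (N + 1) = C (v ++ [a]) N + 1)
    (h2 : C (v ++ [a]) (N + 2) = C (v ++ [a]) (N + 1) + 1) :
    ∃ z : List A, z.length = N ∧
      (∀ f ∈ FF (v ++ [a]) N, f ≠ z → rightValence (v ++ [a]) f ≤ 1) ∧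
      ∃ b c : A, b ≠ c ∧ 
       (∃ x, z ++ [x] <:+: v ++ [a]) ∧ ∀ x, z ++ [x] <:+: v ++ [a] →
        b :: z ++ [x] <:+: v ++ [a] ∧ c :: z ++ [x] <:+: v ++ [a] := by
  set w := v ++ [a] with hw
  have hpos : ∀ f ∈ FF w N, 1 ≤ rightValence w f := fun f hf => rv_pos v f a N (by omega) hP hf
  have hz : ∃ z ∈ FF w N, 1 < rightValence w z := by
    by_contra! hcon
    have : C w (N + 1) ≤ C w N := by
      rw [C_succ, C_eq, Finset.card_eq_sum_ones]
      exact Finset.sum_le_sum hcon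
    omega
  obtain ⟨z, hzF, hz1⟩ := hz
  have hsum : rightValence w z + ∑ f ∈ (FF w N).erase z, rightValence w f
      = ((FF w N).erase z).card + 2 := by
    rw [Finset.add_sum_erase _ _ hzF, ← C_succ, h1, C_eq, Finset.card_erase_of_mem hzF]
    have := Finset.card_pos.2 ⟨z, hzF⟩
    omega
  have hle : ((FF w N).erase z).card ≤ ∑ f ∈ (FF w N).erase z, rightValence w f := by
    rw [Finset.card_eq_sum_ones]
    exact Finset.sum_le_sum fun f hf => hpos f (Finset.mem_of_mem_erase hf)
  have hz2 : rightValence w z = 2 := by omega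
  have hoth : ∀ f ∈ FF w N, f ≠ z → rightValence w f ≤ 1 := by
    intro f hf hne
    have heq : ∑ f ∈ (FF w N).erase z, 1 = ∑ f ∈ (FF w N).erase z, rightValence w f := by
      rw [← Finset.card_eq_sum_ones]; omega
    have := (Finset.sum_eq_sum_iff_of_le
      (fun f hf => hpos f (Finset.mem_of_mem_erase hf))).1 heq f
      (Finset.mem_erase.2 ⟨hne, hf⟩)
    omega
  refine ⟨z, ((mem_FF _ _ _).1 hzF).2, hoth, ?_⟩
  -- factors of length N+1
  have htail : ∀ f ∈ FF w (N + 1), ∃ b g, f = b :: g ∧ g ∈ FF w N := by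
    intro f hf
    rw [mem_FF] at hf
    cases f with
    | nil => simp at hf
    | cons b g =>
      refine ⟨b, g, rfl, ?_⟩
      rw [mem_FF]
      exact ⟨(List.suffix_cons b g).isInfix.trans hf.1, by simpa using hf.2⟩
  have hG2 : ∀ f ∈ FF w (N + 1), 2 ≤ rightValence w f → ∃ b, f = b :: z := by
    intro f hf h
    obtain ⟨b, g, rfl, hg⟩ := htail f hf
    by_cases hgz : g = z
    · exact ⟨b, by rw [hgz]⟩
    · have := hoth g hg hgz
      have := rv_suffix w (b :: g) g (List.suffix_cons b g)
      omega
  have hle2 : ∀ f ∈ FF w (N + 1), rightValence w f ≤ 2 := by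
    intro f hf
    by_contra! h
    obtain ⟨b, rfl⟩ := hG2 f hf (by omega)
    have := rv_suffix w (b :: z) z (List.suffix_cons b z)
    omega
  set e := w.drop (w.length - (N + 1)) with he
  have heF : e ∈ FF w (N + 1) := by
    rw [mem_FF]
    exact ⟨(List.drop_suffix _ _).isInfix, by simp [he, hw]; omega⟩
  have he0 : rightValence w e = 0 := rv_zero _ _ _ hK
  have hGc : 1 < ((FF w (N + 1)).filter (fun f => 2 ≤ rightValence w f)).card := by
    have hs : C w (N + 2) ≤ ∑ f ∈ (FF w (N + 1)).erase e,
        (1 + if 2 ≤ rightValence w f then 1 else 0) := by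
      rw [C_succ, ← Finset.add_sum_erase _ _ heF, he0, zero_add]
      apply Finset.sum_le_sum
      intro f hf
      have := hle2 f (Finset.mem_of_mem_erase hf)
      split_ifs <;> omega
    rw [Finset.sum_add_distrib, ← Finset.card_eq_sum_ones, ← Finset.card_filter,
      Finset.card_erase_of_mem heF, h2, C_eq] at hs
    have := Finset.card_pos.2 ⟨e, heF⟩
    have := Finset.card_le_card (Finset.filter_subset_filter (fun f => 2 ≤ rightValence w f)
      (Finset.erase_subset e (FF w (N + 1))))
    omega
  obtain ⟨f, hf, g, hg, hfg⟩ := Finset.one_lt_card.1 hGc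
  rw [Finset.mem_filter] at hf hg
  obtain ⟨b, rfl⟩ := hG2 f hf.1 hf.2
  obtain ⟨c, rfl⟩ := hG2 g hg.1 hg.2
  have key : ∀ b : A, 2 ≤ rightValence w (b :: z) → ∀ x, z ++ [x] <:+: w →
      b :: z ++ [x] <:+: w := by
    intro b hb x hx
    have := Finset.eq_of_subset_of_card_le (ext_suffix w (b :: z) z (List.suffix_cons b z))
      (by show rightValence w z ≤ rightValence w (b :: z); omega)
    rw [← mem_rext, this, mem_rext]
    exact hx
  refine ⟨b, c, fun h => hfg (by rw [h]), ?_, fun x hx => ⟨key b hf.2 x hx, key c hg.2 x hx⟩⟩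
  have : 0 < rightValence w z := by omega
  obtain ⟨x, hx⟩ := Finset.card_pos.1 this
  exact ⟨x, (mem_rext _ _ _).1 hx⟩

/-- Case `2 ≤ K < m` is impossible. -/
theorem case_low (v : List A) (a : A) (N : ℕ) (hN : N + 1 ≤ v.length + 1)
    (hP : PP v a N) (hK : ¬ PP v a (N + 1))
    (h1 : C (v ++ [a]) (N + 1) = C (v ++ [a]) N + 1)
    (h2 : C (v ++ [a]) (N + 2) = C (v ++ [a]) (N + 1) + 1) : False := by
  obtain ⟨z, hzl, hoth, b, c, hbc, ⟨x0, hx0⟩, hext⟩ := exists_z v a N hN hP hK h1 h2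
  have hwl : (v ++ [a]).length = v.length + 1 := by simp
  unfold PP at hK
  set w := v ++ [a] with hw
  -- last position of z
  set Q : ℕ → Prop := fun i => (w.drop i).take N = z with hQ
  obtain ⟨i0, hi0, hi0'⟩ := infix_win w _ hx0
  have hQi0 : Q i0 := by
    have := congrArg (List.take N) hi0'
    rw [List.take_take, List.take_append_of_le_length (by omega),
      List.take_of_length_le (by omega : z.length ≤ N)] at this
    rw [hQ]
    simpa [hzl] using this
  rw [List.length_append, hzl, List.length_singleton] at hi0
  classical
  set j := Nat.findGreatest Q (w.length - (N + 1)) with hj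
  have hQj : Q j := Nat.findGreatest_spec (P := Q) (by omega : i0 ≤ w.length - (N + 1)) hQi0
  have hjle : j ≤ w.length - (N + 1) := Nat.findGreatest_le _
  have hjmax : ∀ i, j < i → i ≤ w.length - (N + 1) → ¬ Q i := fun i h h' =>
    Nat.findGreatest_is_greatest h h'
  have hjN : j + N < w.length := by omega
  -- z x occurs at j
  have hzx := win_succ w j N hjN
  rw [show (w.drop j).take N = z from hQj] at hzx
  set x := w[j + N] with hx
  have hxin : z ++ [x] <:+: w := by rw [hzx]; exact win_infix _ _ _
  obtain ⟨hb, hc⟩ := hext x hxin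
  -- second occurrence
  have hocc : ∀ d : A, d :: z ++ [x] <:+: w → ∃ p, p + (N + 2) ≤ w.length ∧ w[p]? = some d ∧
      (w.drop (p + 1)).take (N + 1) = z ++ [x] := by
    intro d hd
    obtain ⟨p, hp, hp'⟩ := infix_win w _ hd
    have hl : (d :: z ++ [x]).length = N + 2 := by simp [hzl]
    rw [hl] at hp hp'
    refine ⟨p, hp, ?_, ?_⟩
    · have := congrArg (fun l => l[0]?) hp'
      simpa using this
    · have := congrArg (List.drop 1) hp'
      rw [List.drop_take, List.drop_drop] at this
      simpa using this
  obtain ⟨p, hp, hpb, hp'⟩ := hocc b hb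
  obtain ⟨q, hq, hqc, hq'⟩ := hocc c hc
  have hpq : p ≠ q := by
    rintro rfl
    rw [hpb] at hqc
    exact hbc (by simpa using hqc)
  have hj' : ∃ j', j' ≠ j ∧ j' + (N + 1) ≤ w.length ∧ (w.drop j').take (N + 1) = z ++ [x] := by
    by_cases h : p + 1 = j
    · exact ⟨q + 1, by omega, by omega, hq'⟩
    · exact ⟨p + 1, h, by omega, hp'⟩
  obtain ⟨j', hne, hj'l, hj'z⟩ := hj'
  have hQj' : Q j' := by
    have := congrArg (List.take N) hj'z
    rw [List.take_take, List.take_append_of_le_length (by omega),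
      List.take_of_length_le (by omega : z.length ≤ N)] at this
    rw [hQ]
    simpa using this
  have hlt : j' < j := by
    by_contra! h
    exact hjmax j' (by omega) (by omega) hQj'
  -- determinism
  have hdet : ∀ r, j + r < w.length → w[j + r]? = w[j' + r]? := by
    intro r
    induction r using Nat.strong_induction_on with
    | _ r ih =>
      intro hr
      by_cases hrN : r < N + 1
      · exact win_get w j j' (N + 1) r (by rw [hj'z, hzx]) hrN
      · have hwin : (w.drop (j + (r - N))).take N = (w.drop (j' + (r - N))).take N := by
          apply win_ext
          intro s hs
          have := ih (r - N + s) (by omega) (by omega)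
          rw [add_assoc, add_assoc]; exact this
        have hnz : (w.drop (j + (r - N))).take N ≠ z := hjmax _ (by omega) (by omega)
        have hF : (w.drop (j + (r - N))).take N ∈ FF w N := by
          rw [mem_FF]
          exact ⟨win_infix _ _ _, by simp; omega⟩
        have hrv := hoth _ hF hnz
        have e1 := win_succ w (j + (r - N)) N (by omega)
        have e2 := win_succ w (j' + (r - N)) N (by omega)
        rw [← hwin] at e2
        have := rv_unique w _ _ _ hrv (by rw [e1]; exact win_infix _ _ _)
          (by rw [e2]; exact win_infix _ _ _)
        have i1 : j + r = j + (r - N) + N := by omega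
        have i2 : j' + r = j' + (r - N) + N := by omega
        rw [i1, i2, List.getElem?_eq_getElem (by omega), List.getElem?_eq_getElem (by omega), this]
  apply hK
  obtain ⟨d, hd⟩ : ∃ d, w.length - (N + 1) = j + d := ⟨w.length - (N + 1) - j, by omega⟩
  have hfin : (w.drop (j + d)).take (N + 1) = (w.drop (j' + d)).take (N + 1) := by
    apply win_ext
    intro s hs
    have := hdet (d + s) (by omega)
    rw [add_assoc, add_assoc]; exact this
  rw [List.take_of_length_le (by rw [List.length_drop]; omega)] at hfin
  rw [hd, hfin]
  have e2 := win_succ w (j' + d) (N + 1) (by omega)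
  apply ext_infix v _ a w[j' + d + (N + 1)]
  rw [e2]
  exact win_infix _ _ _

theorem GT_snoc (v : List A) (a : A) (hv : v ≠ []) (hw : IsGT (v ++ [a])) : IsGT v := by
  refine ⟨hv, ?_⟩
  have hvA : 0 < (Alph v).card := by
    obtain ⟨x, hx⟩ := List.exists_mem_of_ne_nil v hv
    exact Finset.card_pos.2 ⟨x, by simpa [Alph] using hx⟩
  obtain ⟨-, hw⟩ := hw
  by_cases hk1 : (Alph (v ++ [a])).card = 1
  · left
    have : (Alph v).card ≤ (Alph (v ++ [a])).card := by
      apply Finset.card_le_card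
      intro x hx
      simp only [Alph, List.mem_toFinset, List.mem_append] at *
      exact Or.inl hx
    omega
  right
  obtain ⟨m, M, hm, hmM, c1, c2, c3⟩ := hw.resolve_left hk1
  have hlen : (v ++ [a]).length = v.length + 1 := by simp
  rw [hlen] at c3
  have hCn : C (v ++ [a]) (v.length + 1) = 1 := by rw [← hlen]; exact C_len _
  have hCn1 : C (v ++ [a]) (v.length + 1 + 1) = 0 := C_big _ _ (by omega)
  have hpos : ∀ i ≤ v.length + 1, 0 < C (v ++ [a]) i := fun i hi => C_pos _ _ (by omega)
  have hA := C_one (v ++ [a])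
  have hAv := C_one v
  have hMn : M ≤ v.length + 1 := by
    by_contra! h
    by_cases hmn : m ≤ v.length + 1
    · have := c2 (v.length + 1) hmn (by omega)
      omega
    · have := c1 (v.length + 1 + 1) (by omega) (by omega)
      omega
  classical
  have hex : ∃ k, ¬ PP v a k := ⟨v.length + 1, by
    intro h
    have := h.length_le
    simp at this⟩
  set k := Nat.find hex with hkdef
  have hk : ¬ PP v a k := Nat.find_spec hex
  have hkn : k ≤ v.length + 1 := Nat.find_min' hex (by
    intro h
    have := h.length_le
    simp at this)
  have hlow : ∀ i < k, PP v a i := fun i hi => not_not.1 (Nat.find_min hex hi)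
  have hhigh : ∀ i, k ≤ i → ¬ PP v a i := fun i hi h => hk (PP_mono v a k i hi h)
  have hk0 : 0 < k := by
    rcases Nat.eq_zero_or_pos k with h | h
    · exfalso; apply hk; rw [h]; unfold PP; simp
    · exact h
  have D1 : ∀ i < k, C (v ++ [a]) i = C v i := fun i hi =>
    C_snoc_pos v a i (by omega) (hlow i hi)
  have D2 : ∀ i, k ≤ i → i ≤ v.length + 1 → C (v ++ [a]) i = C v i + 1 := fun i hi hi' =>
    C_snoc_neg v a i hi' (hhigh i hi)
  -- K ≤ M
  have hkM : k ≤ M := by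
    by_contra! h
    have h1 := C_mono_PP v a M hMn (hlow M h)
    have h2 := c3 M le_rfl hMn
    have h3 := hpos M hMn
    omega
  by_cases hkone : k = 1
  · have d1 := D2 1 (by omega) (by omega)
    refine ⟨m, M, hm, hmM, ?_, ?_, ?_⟩
    · intro i hi him
      have := c1 i hi him
      have := D2 i (by omega) (by omega)
      omega
    · intro i hi hi'
      have := c2 i hi hi'
      have := D2 i (by omega) (by omega)
      have := D2 (i + 1) (by omega) (by omega)
      omega
    · intro i hi hi'
      have := c3 i hi (by omega)
      have := D2 i (by omega) (by omega)
      have := D2 (i + 1) (by omega) (by omega)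
      omega
  have d1 := D1 1 (by omega)
  have hmk : m ≤ k := by
    by_contra! h
    obtain ⟨N, hN⟩ : ∃ N, k = N + 1 := ⟨k - 1, by omega⟩
    have a1 := c1 N (by omega) (by omega)
    have a2 := c1 (N + 1) (by omega) (by omega)
    have a3 := c1 (N + 2) (by omega) (by omega)
    exact case_low v a N (by omega) (hlow N (by omega)) (hN ▸ hk) (by omega) (by omega)
  have hcase : k = m ∨ (k = M ∧ m < M) := by
    by_contra! h
    have hlt : m < k := by omega
    have hlt2 : k < M := by
      rcases Nat.lt_or_ge k M with h' | h'
      · exact h'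
      · have := h.2 (by omega); omega
    exact case_mid v a m k hkn hmk (hlow m hlt) hk (c2 m le_rfl (by omega)) (c2 k hmk (by omega))
  rcases hcase with hkm | ⟨hkM', hmM'⟩
  · refine ⟨m - 1, M, by omega, by omega, ?_, ?_, ?_⟩
    · intro i hi him
      have := c1 i hi (by omega)
      have := D1 i (by omega)
      omega
    · intro i hi hi'
      by_cases him : i + 1 = m
      · have := c1 i (by omega) (by omega)
        have := c1 (i + 1) (by omega) (by omega)
        have := D1 i (by omega)
        have := D2 (i + 1) (by omega) (by omega)
        omega
      · have := c2 i (by omega) hi'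
        have := D2 i (by omega) (by omega)
        have := D2 (i + 1) (by omega) (by omega)
        omega
    · intro i hi hi'
      have := c3 i hi (by omega)
      have := D2 i (by omega) (by omega)
      have := D2 (i + 1) (by omega) (by omega)
      omega
  · refine ⟨m, M - 1, hm, by omega, ?_, ?_, ?_⟩
    · intro i hi him
      have := c1 i hi (by omega)
      have := D1 i (by omega)
      omega
    · intro i hi hi'
      have := c2 i hi (by omega)
      have := D1 i (by omega)
      have := D1 (i + 1) (by omega)
      omega
    · intro i hi hi'
      by_cases him : i + 1 = M
      · have := c2 i (by omega) (by omega)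
        have := D1 i (by omega)
        have := D2 (i + 1) (by omega) (by omega)
        omega
      · have := c3 i (by omega) (by omega)
        have := D2 i (by omega) (by omega)
        have := D2 (i + 1) (by omega) (by omega)
        omega

theorem GT_prefix (u t : List A) (hu : u ≠ []) (hw : IsGT (u ++ t)) : IsGT u := by
  induction t using List.reverseRecOn with
  | nil => simpa using hw
  | append_singleton t b ih =>
    apply ih
    apply GT_snoc (u ++ t) b (by simp [hu])
    simpa using hw

theorem stmt11 (w u : List A) (hw : IsGT w) (hu : u ≠ []) (hfac : u <:+: w) :
    IsGT u := by
  obtain ⟨s, t, rfl⟩ := hfac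
  have h1 : IsGT (s ++ u) := GT_prefix (s ++ u) t (by simp [hu]) hw
  have h2 := GT_rev _ h1
  rw [List.reverse_append] at h2
  have h3 := GT_rev _ (GT_prefix u.reverse s.reverse (by simpa using hu) h2)
  simpa using h3
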